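/- arXiv:0806.1348 — 2 statements merged into one kernel-verified Lean document; each statement's English description precedes it below -/
import Mathlib

section
/- Every graph that admits a proper 3-edge-coloring is $(7,2)$-edge-choosable: for any assignment of lists of size 7 to its edges, one can choose 2 colors per edge from its list so that incident edges receive disjoint color sets. -/
/-- Two edges are incident if they share a vertex. -/
def EdgeIncident {V : Type*} (e f : Sym2 V) : Prop := ∃ v, v ∈ e ∧ v ∈ f

/-- `G` is `(r,s)`-edge-choosable: from any assignment of `r`-element lists to the edges one can
select `s` colors per edge from its list so that incident edges receive disjoint sets. -/
def EdgeChoosable {V : Type*} (G : SimpleGraph V) (r s : ℕ) : Prop :=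
  ∀ L : Sym2 V → Finset ℕ, (∀ e ∈ G.edgeSet, (L e).card = r) →
    ∃ C : Sym2 V → Finset ℕ,
      (∀ e ∈ G.edgeSet, C e ⊆ L e ∧ (C e).card = s) ∧
      ∀ e ∈ G.edgeSet, ∀ f ∈ G.edgeSet, e ≠ f → EdgeIncident e f → Disjoint (C e) (C f)

/-- Degree of a vertex, measured as the number of its neighbors. -/
noncomputable def edeg {V : Type*} (H : SimpleGraph V) (v : V) : ℕ := (H.neighborSet v).ncard

/-- In a finite bipartite incidence structure in which every object meets at most two others,
if the lists on one side are at least as large as the lists of the incident objects on the other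
side, then one color per object `x ∈ X` can be selected so that each list `M e` sees at most one
of the colors selected next to `e`. The two parts are proved together: in the first one, the
color of an object incident to at most one `e` is prescribed. -/
theorem exists_selection_aux {ι κ : Type*} [DecidableEq ι] [DecidableEq κ] (I : ι → κ → Prop)
    (L : ι → Finset ℕ) (M : κ → Finset ℕ) (n : ℕ) :
    (∀ (X : Finset ι) (T : Finset κ), X.card = n →
      (∀ x ∈ X, (L x).Nonempty) →
      (∀ x ∈ X, ∀ e ∈ T, I x e → (M e).card ≤ (L x).card) →
      (∀ x ∈ X, ∀ e₁ ∈ T, ∀ e₂ ∈ T, ∀ e₃ ∈ T, I x e₁ → I x e₂ → I x e₃ →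
        e₁ = e₂ ∨ e₁ = e₃ ∨ e₂ = e₃) →
      (∀ e ∈ T, ∀ x₁ ∈ X, ∀ x₂ ∈ X, ∀ x₃ ∈ X, I x₁ e → I x₂ e → I x₃ e →
        x₁ = x₂ ∨ x₁ = x₃ ∨ x₂ = x₃) →
      ∀ x₀ ∈ X, ∀ a₀ ∈ L x₀, (∀ e ∈ T, ∀ f ∈ T, I x₀ e → I x₀ f → e = f) →
      ∃ a : ι → ℕ, a x₀ = a₀ ∧ (∀ x ∈ X, a x ∈ L x) ∧
        ∀ e ∈ T, ∀ x ∈ X, ∀ y ∈ X, I x e → I y e → a x ∈ M e → a y ∈ M e → a x = a y) ∧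
    (∀ (X : Finset ι) (T : Finset κ), X.card = n →
      (∀ x ∈ X, (L x).Nonempty) →
      (∀ x ∈ X, ∀ e ∈ T, I x e → (M e).card ≤ (L x).card) →
      (∀ x ∈ X, ∀ e₁ ∈ T, ∀ e₂ ∈ T, ∀ e₃ ∈ T, I x e₁ → I x e₂ → I x e₃ →
        e₁ = e₂ ∨ e₁ = e₃ ∨ e₂ = e₃) →
      (∀ e ∈ T, ∀ x₁ ∈ X, ∀ x₂ ∈ X, ∀ x₃ ∈ X, I x₁ e → I x₂ e → I x₃ e →
        x₁ = x₂ ∨ x₁ = x₃ ∨ x₂ = x₃) →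
      ∃ a : ι → ℕ, (∀ x ∈ X, a x ∈ L x) ∧
        ∀ e ∈ T, ∀ x ∈ X, ∀ y ∈ X, I x e → I y e → a x ∈ M e → a y ∈ M e → a x = a y) := by
  induction n with
  | zero =>
    refine ⟨fun X T hX _ _ _ _ x₀ hx₀ => ?_, fun X T hX _ _ _ _ => ⟨fun _ => 0, ?_⟩⟩
    · simp_all
    · simp_all
  | succ n ih =>
    obtain ⟨ih₁, ih₂⟩ := ih
    rw [and_iff_left_of_imp]
    · intro X T hX hne hcard hx he x₀ hx₀ a₀ ha₀ huniq
      have hX' : (X.erase x₀).card = n := by rw [Finset.card_erase_of_mem hx₀, hX]; rfl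
      by_cases hnb : ∃ e ∈ T, ∃ y ∈ X, y ≠ x₀ ∧ I x₀ e ∧ I y e
      · obtain ⟨e, heT, y, hy, hyx, hxe, hye⟩ := hnb
        obtain ⟨b, hb, hba⟩ : ∃ b ∈ L y, a₀ ∈ M e → b ∈ M e → b = a₀ := by
          by_cases hsub : L y ⊆ M e
          · have hLM := Finset.eq_of_subset_of_card_le hsub (hcard y hy e heT hye)
            by_cases ha : a₀ ∈ M e
            · exact ⟨a₀, hLM ▸ ha, fun _ _ => rfl⟩
            · obtain ⟨b, hb⟩ := hne y hy
              exact ⟨b, hb, fun h => absurd h ha⟩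
          · obtain ⟨b, hb, hb'⟩ := Finset.not_subset.1 hsub
            exact ⟨b, hb, fun _ h => absurd h hb'⟩
        obtain ⟨a, hay, haL, haM⟩ := ih₁ (X.erase x₀) (T.erase e) hX'
          (by grind) (by grind) (by grind) (by grind) y (by grind) b hb (by grind)
        refine ⟨Function.update a x₀ a₀, by simp, fun x hxX => ?_, fun f hf x hxX z hzX => ?_⟩
        · by_cases h : x = x₀
          · subst h; simpa using ha₀
          · simpa [h] using haL x (by grind)
        · by_cases hfe : f = e
          · subst hfe
            have h₁ := he f hf x₀ hx₀ y hy x hxX hxe hye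
            have h₂ := he f hf x₀ hx₀ y hy z hzX hxe hye
            grind
          · have h₁ := haM f (by grind) x
            grind
      · push Not at hnb
        obtain ⟨a, haL, haM⟩ := ih₂ (X.erase x₀) T hX'
          (by grind) (by grind) (by grind) (by grind)
        refine ⟨Function.update a x₀ a₀, by simp, fun x hxX => ?_, fun f hf x hxX z hzX => ?_⟩
        · by_cases h : x = x₀
          · subst h; simpa using ha₀
          · simpa [h] using haL x (by grind)
        · have h₁ := haM f hf x
          have h₂ := hnb f hf
          grind
    · intro h₁ X T hX hne hcard hx he
      by_cases hbad : ∃ e ∈ T, ∃ x ∈ X, I x e ∧ ¬ L x ⊆ M e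
      · obtain ⟨e, heT, x, hxX, hxe, hsub⟩ := hbad
        obtain ⟨b, hb, hb'⟩ := Finset.not_subset.1 hsub
        obtain ⟨a, hax, haL, haM⟩ := h₁ X (T.erase e) hX
          (by grind) (by grind) (by grind) (by grind) x hxX b hb (by grind)
        refine ⟨a, haL, fun f hf y hy z hz hyf hzf => ?_⟩
        by_cases hfe : f = e
        · subst hfe
          have := he f hf x hxX y hy z hz hxe hyf hzf
          grind
        · exact haM f (by grind) y hy z hz hyf hzf
      · push Not at hbad
        have hLM : ∀ e ∈ T, ∀ x ∈ X, I x e → L x = M e := fun e he' x hx' h =>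
          Finset.eq_of_subset_of_card_le (hbad e he' x hx' h) (hcard x hx' e he' h)
        refine ⟨fun x => sInf (L x : Set ℕ), fun x hx' => ?_, fun e he' x hx' y hy' hxe hye _ _ => ?_⟩
        · exact_mod_cast Nat.sInf_mem (s := (L x : Set ℕ)) (hne x hx')
        · simp only [hLM e he' x hx' hxe, hLM e he' y hy' hye]

/-- A kernel exists in every finite bipartite digraph with outdegrees at most one. -/
theorem exists_kernel {ι : Type*} [DecidableEq ι] (out : ι → ι → Prop) (p : ι → Prop)
    (hp : ∀ f g, out f g → (p f ↔ ¬ p g)) (S : Finset ι) :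
    ∃ K ⊆ S, (∀ f ∈ K, ∀ g ∈ K, ¬ out f g) ∧ ∀ f ∈ S, f ∉ K → ∃ g ∈ K, out f g := by
  classical
  induction S using Finset.strongInduction with
  | H S ih =>
    by_cases hs : ∃ s ∈ S, ∀ g ∈ S, ¬ out s g
    · obtain ⟨s, hsS, hs⟩ := hs
      have hlt : S.filter (fun f => f ≠ s ∧ ¬ out f s) ⊂ S :=
        Finset.filter_ssubset.2 ⟨s, hsS, by simp⟩
      obtain ⟨K, hKS, hK, hdom⟩ := ih _ hlt
      refine ⟨insert s K, ?_, ?_, ?_⟩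
      · grind
      · intro f hf g hg
        have h₁ := hs s hsS
        grind
      · intro f hf hfK
        by_cases hfs : out f s
        · exact ⟨s, by simp, hfs⟩
        · obtain ⟨g, hg, hfg⟩ := hdom f (by grind) (by grind)
          exact ⟨g, by simp [hg], hfg⟩
    · push Not at hs
      refine ⟨S.filter p, Finset.filter_subset _ _, ?_, ?_⟩
      · intro f hf g hg hfg
        have := hp f g hfg
        grind
      · intro f hf hfK
        obtain ⟨g, hg, hfg⟩ := hs f hf
        have := hp f g hfg
        exact ⟨g, by grind, hfg⟩

/-- Multiple list coloring of a finite bipartite digraph with outdegrees at most one. -/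
theorem exists_multicoloring {ι : Type*} [DecidableEq ι] (out : ι → ι → Prop) (p : ι → Prop)
    (hp : ∀ f g, out f g → (p f ↔ ¬ p g)) (huniq : ∀ f g h, out f g → out f h → g = h)
    (W : Finset ι) (n : ℕ) (d : ι → ℕ) (hn : ∑ f ∈ W, d f = n) (L : ι → Finset ℕ)
    (hd : ∀ f ∈ W, 0 < d f → d f ≤ (L f).card)
    (hdd : ∀ f ∈ W, 0 < d f → ∀ g ∈ W, out f g → d f + d g ≤ (L f).card) :
    ∃ C : ι → Finset ℕ, (∀ f ∈ W, C f ⊆ L f ∧ (C f).card = d f) ∧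
      ∀ f ∈ W, ∀ g ∈ W, out f g → Disjoint (C f) (C g) := by
  induction n using Nat.strong_induction_on generalizing d L with
  | _ n ih =>
    by_cases hpos : ∃ f ∈ W, 0 < d f
    · obtain ⟨f₀, hf₀, hdf₀⟩ := hpos
      obtain ⟨c, hc⟩ : (L f₀).Nonempty := Finset.card_pos.1 (hdf₀.trans_le (hd f₀ hf₀ hdf₀))
      obtain ⟨K, hKS, hK, hdom⟩ :=
        exists_kernel out p hp (W.filter fun f => 0 < d f ∧ c ∈ L f)
      have hKne : ∃ k, k ∈ K := by
        by_cases h : f₀ ∈ K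
        · exact ⟨f₀, h⟩
        · obtain ⟨g, hg, -⟩ := hdom f₀ (by grind) h
          exact ⟨g, hg⟩
      obtain ⟨k, hk⟩ := hKne
      have hKW : ∀ f ∈ K, f ∈ W ∧ 0 < d f ∧ c ∈ L f := fun f hf => by
        simpa using hKS hf
      let d' : ι → ℕ := fun f => if f ∈ K then d f - 1 else d f
      have hlt : ∑ f ∈ W, d' f < n := by
        rw [← hn]
        refine Finset.sum_lt_sum (fun f _ => ?_) ⟨k, (hKW k hk).1, ?_⟩
        · simp only [d']; split_ifs <;> omega
        · have := hKW k hk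
          simp only [d', hk, if_true]; omega
      have hcard : ∀ f, ((L f).erase c).card = if c ∈ L f then (L f).card - 1 else (L f).card :=
        fun f => Finset.card_erase_eq_ite
      obtain ⟨C, hC, hdisj⟩ := ih _ hlt d' rfl (fun f => (L f).erase c)
        (by
          intro f hf hdf
          have hle := hd f hf
          rw [hcard]
          by_cases hfK : f ∈ K
          · have := hKW f hfK
            simp only [d', hfK, if_true] at hdf ⊢
            simp only [this.2.2, if_true]; omega
          · simp only [d', hfK, if_false] at hdf ⊢
            split_ifs with hcf
            · obtain ⟨g, hg, hfg⟩ := hdom f (by grind) hfK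
              have h₁ := hdd f hf hdf g (hKW g hg).1 hfg
              have h₂ := hKW g hg
              omega
            · exact hle hdf)
        (by
          intro f hf hdf g hg hfg
          have hle := hdd f hf
          have hdg : d' g ≤ d g := by simp only [d']; split_ifs <;> omega
          rw [hcard]
          by_cases hfK : f ∈ K
          · have h₁ := hKW f hfK
            have h₂ := hle h₁.2.1 g hg hfg
            simp only [d', hfK, if_true] at hdf hdg ⊢
            simp only [h₁.2.2, if_true]; omega
          · have hdf' : d' f = d f := by simp only [d', hfK, if_false]
            rw [hdf'] at hdf ⊢
            have h₂ := hle hdf g hg hfg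
            split_ifs with hcf
            · obtain ⟨g', hg', hfg'⟩ := hdom f (by grind) hfK
              obtain rfl := huniq f g g' hfg hfg'
              have h₃ := hKW g hg'
              have h₄ : d' g = d g - 1 := by simp only [d', hg', if_true]
              omega
            · omega)
      refine ⟨fun f => if f ∈ K then insert c (C f) else C f, fun f hf => ?_,
        fun f hf g hg hfg => ?_⟩
      · obtain ⟨h₁, h₂⟩ := hC f hf
        have hcC : c ∉ C f := fun h => by simpa using h₁ h
        have h₃ : C f ⊆ L f := h₁.trans (Finset.erase_subset _ _)
        by_cases hfK : f ∈ K
        · have h₄ := hKW f hfK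
          simp only [d', hfK, if_true] at h₂ ⊢
          refine ⟨Finset.insert_subset h₄.2.2 h₃, ?_⟩
          rw [Finset.card_insert_of_notMem hcC]; omega
        · simp only [d', hfK, if_false] at h₂ ⊢
          exact ⟨h₃, h₂⟩
      · have hcf : c ∉ C f := fun h => by simpa using (hC f hf).1 h
        have hcg : c ∉ C g := fun h => by simpa using (hC g hg).1 h
        have h₁ := hdisj f hf g hg hfg
        have h₂ := hK f
        dsimp only
        split_ifs with hfK hgK hgK
        · exact absurd hfg (h₂ hfK g hgK)
        · exact Finset.disjoint_insert_left.2 ⟨hcg, h₁⟩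
        · exact Finset.disjoint_insert_right.2 ⟨hcf, h₁⟩
        · exact h₁
    · push Not at hpos
      refine ⟨fun _ => ∅, fun f hf => ⟨by simp, ?_⟩, by simp⟩
      have := hpos f hf
      simp; omega

theorem EdgeIncident.symm {V : Type*} {e f : Sym2 V} (h : EdgeIncident e f) :
    EdgeIncident f e :=
  let ⟨v, h₁, h₂⟩ := h
  ⟨v, h₂, h₁⟩

/-- Among three edges incident to a common edge, two are incident to each other. -/
theorem EdgeIncident.pigeonhole {V : Type*} {x e₁ e₂ e₃ : Sym2 V} (h₁ : EdgeIncident x e₁)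
    (h₂ : EdgeIncident x e₂) (h₃ : EdgeIncident x e₃) :
    EdgeIncident e₁ e₂ ∨ EdgeIncident e₁ e₃ ∨ EdgeIncident e₂ e₃ := by
  induction x with
  | _ a b =>
    obtain ⟨u, hu, hu'⟩ := h₁
    obtain ⟨v, hv, hv'⟩ := h₂
    obtain ⟨w, hw, hw'⟩ := h₃
    rw [Sym2.mem_iff] at hu hv hw
    unfold EdgeIncident
    rcases hu with rfl | rfl <;> rcases hv with rfl | rfl <;> rcases hw with rfl | rfl <;>
      first
        | exact Or.inl ⟨_, hu', hv'⟩
        | exact Or.inr (Or.inl ⟨_, hu', hw'⟩)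
        | exact Or.inr (Or.inr ⟨_, hv', hw'⟩)

/-- Two matchings: one color can be selected for every edge of the first one so that every edge
of the second one sees at most one selected color from its list. -/
theorem exists_matching_selection {V : Type*} [DecidableEq V] (X T : Finset (Sym2 V))
    (hX : ∀ e ∈ X, ∀ f ∈ X, e ≠ f → ¬ EdgeIncident e f)
    (hT : ∀ e ∈ T, ∀ f ∈ T, e ≠ f → ¬ EdgeIncident e f) (L : Sym2 V → Finset ℕ)
    (hne : ∀ x ∈ X, (L x).Nonempty) (hcard : ∀ x ∈ X, ∀ e ∈ T, (L e).card ≤ (L x).card) :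
    ∃ a : Sym2 V → ℕ, (∀ x ∈ X, a x ∈ L x) ∧
      ∀ e ∈ T, ∀ x ∈ X, ∀ y ∈ X, EdgeIncident x e → EdgeIncident y e →
        a x ∈ L e → a y ∈ L e → a x = a y := by
  refine (exists_selection_aux EdgeIncident L L X.card).2 X T rfl hne
    (fun x hx e he _ => hcard x hx e he) ?_ ?_
  · intro x _ e₁ h₁ e₂ h₂ e₃ h₃ i₁ i₂ i₃
    have := EdgeIncident.pigeonhole i₁ i₂ i₃
    have := hT e₁ h₁ e₂ h₂
    have := hT e₁ h₁ e₃ h₃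
    have := hT e₂ h₂ e₃ h₃
    tauto
  · intro x _ e₁ h₁ e₂ h₂ e₃ h₃ i₁ i₂ i₃
    have := EdgeIncident.pigeonhole i₁.symm i₂.symm i₃.symm
    have := hX e₁ h₁ e₂ h₂
    have := hX e₁ h₁ e₃ h₃
    have := hX e₂ h₂ e₃ h₃
    tauto

/-- An edge meets at most two edges of a matching. -/
theorem card_filter_edgeIncident_le {V : Type*} (X : Finset (Sym2 V))
    (hX : ∀ e ∈ X, ∀ f ∈ X, e ≠ f → ¬ EdgeIncident e f) (e : Sym2 V)
    [DecidablePred fun x => EdgeIncident x e] :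
    (X.filter fun x => EdgeIncident x e).card ≤ 2 := by
  by_contra! h
  obtain ⟨x, hx, y, hy, z, hz, hxy, hxz, hyz⟩ := Finset.two_lt_card.1 h
  simp only [Finset.mem_filter] at hx hy hz
  have := EdgeIncident.pigeonhole hx.2.symm hy.2.symm hz.2.symm
  have := hX x hx.1 y hy.1 hxy
  have := hX x hx.1 z hz.1 hxz
  have := hX y hy.1 z hz.1 hyz
  tauto

/-- The shared vertices of two matchings can be distributed injectively to edges containing
them. -/
theorem exists_owner {V : Type*} [DecidableEq V] (A B : Finset (Sym2 V)) (hAB : Disjoint A B) :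
    ∃ o : {v : V // (∃ e ∈ A, v ∈ e) ∧ ∃ e ∈ B, v ∈ e} → Sym2 V, Function.Injective o ∧
      ∀ v, o v ∈ (A ∪ B).filter (fun e => v.1 ∈ e) := by
  classical
  refine (Finset.all_card_le_biUnion_card_iff_exists_injective
    (fun v : {v : V // (∃ e ∈ A, v ∈ e) ∧ ∃ e ∈ B, v ∈ e} =>
      (A ∪ B).filter (fun e => (v : V) ∈ e))).1 fun s => ?_
  refine Nat.le_of_mul_le_mul_right (c := 2) ?_ two_pos
  refine Finset.card_mul_le_card_mul (fun v (e : Sym2 V) => v.1 ∈ e) ?_ ?_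
  · rintro ⟨v, ⟨e, he, hve⟩, f, hf, hvf⟩ hv
    have hef : e ≠ f := fun h => Finset.disjoint_left.1 hAB he (h ▸ hf)
    rw [← Finset.card_pair hef]
    refine Finset.card_le_card fun g hg => ?_
    simp only [Finset.mem_insert, Finset.mem_singleton] at hg
    simp only [Finset.mem_bipartiteAbove, Finset.mem_biUnion, Finset.mem_filter, Finset.mem_union]
    rcases hg with rfl | rfl
    · exact ⟨⟨_, hv, Or.inl he, hve⟩, hve⟩
    · exact ⟨⟨_, hv, Or.inr hf, hvf⟩, hvf⟩
  · intro e _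
    induction e with
    | _ a b =>
      rw [← Finset.card_map (Function.Embedding.subtype _)]
      refine (Finset.card_le_card (t := {a, b}) fun v hv => ?_).trans Finset.card_le_two
      simp only [Finset.mem_map, Finset.mem_bipartiteBelow] at hv
      obtain ⟨w, ⟨-, hw⟩, rfl⟩ := hv
      simpa using hw

/-- The union of two disjoint finite matchings is `(4,2)`-edge-choosable. -/
theorem exists_coloring_of_two_matchings {V : Type*} [DecidableEq V] (A B : Finset (Sym2 V))
    (hAB : Disjoint A B) (hA : ∀ e ∈ A, ∀ f ∈ A, e ≠ f → ¬ EdgeIncident e f)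
    (hB : ∀ e ∈ B, ∀ f ∈ B, e ≠ f → ¬ EdgeIncident e f) (L : Sym2 V → Finset ℕ)
    (hL : ∀ e ∈ A ∪ B, 4 ≤ (L e).card) :
    ∃ C : Sym2 V → Finset ℕ, (∀ e ∈ A ∪ B, C e ⊆ L e ∧ (C e).card = 2) ∧
      ∀ e ∈ A ∪ B, ∀ f ∈ A ∪ B, e ≠ f → EdgeIncident e f → Disjoint (C e) (C f) := by
  obtain ⟨o, ho, hmem⟩ := exists_owner A B hAB
  let out : Sym2 V → Sym2 V → Prop := fun e f =>
    (e ∈ A ∧ f ∈ B ∨ e ∈ B ∧ f ∈ A) ∧ ∃ v, o v = e ∧ v.1 ∈ f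
  have hdisj : ∀ e, e ∈ A → e ∉ B := fun _ => (Finset.disjoint_left.1 hAB ·)
  obtain ⟨C, hC, hCd⟩ := exists_multicoloring out (· ∈ A)
    (by
      rintro e f ⟨h, -⟩
      have := hdisj e
      have := hdisj f
      tauto)
    (by
      rintro e f g ⟨h, v, hv, hvf⟩ ⟨h', w, hw, hwg⟩
      obtain rfl := ho (hv.trans hw.symm)
      by_contra hfg
      have hi : EdgeIncident f g := ⟨v, hvf, hwg⟩
      have := hdisj e
      have := hA f
      have := hB f
      grind)
    (A ∪ B) _ (fun _ => 2) rfl L (fun e he _ => le_trans (by norm_num) (hL e he))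
    (fun e he _ f _ _ => hL e he)
  refine ⟨C, hC, fun e he f hf hef ⟨v, hve, hvf⟩ => ?_⟩
  have key : ∀ e ∈ A, ∀ f ∈ B, v ∈ e → v ∈ f → Disjoint (C e) (C f) := by
    intro e he f hf hve hvf
    let w : {v : V // (∃ e ∈ A, v ∈ e) ∧ ∃ e ∈ B, v ∈ e} := ⟨v, ⟨e, he, hve⟩, f, hf, hvf⟩
    have hw := hmem w
    simp only [Finset.mem_filter, Finset.mem_union] at hw
    have hwe : o w = e ∨ o w = f := by
      rcases hw with ⟨h | h, hv⟩
      · exact Or.inl (by_contra fun hne => hA _ h _ he hne ⟨v, hv, hve⟩)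
      · exact Or.inr (by_contra fun hne => hB _ h _ hf hne ⟨v, hv, hvf⟩)
    have heAB : e ∈ A ∪ B := Finset.mem_union_left _ he
    have hfAB : f ∈ A ∪ B := Finset.mem_union_right _ hf
    rcases hwe with h | h
    · exact hCd e heAB f hfAB ⟨Or.inl ⟨he, hf⟩, w, h, hvf⟩
    · exact (hCd f hfAB e heAB ⟨Or.inr ⟨hf, he⟩, w, h, hve⟩).symm
  rcases Finset.mem_union.1 he with he | he <;> rcases Finset.mem_union.1 hf with hf | hf
  · exact absurd ⟨v, hve, hvf⟩ (hA e he f hf hef)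
  · exact key e he f hf hve hvf
  · exact (key f hf e he hvf hve).symm
  · exact absurd ⟨v, hve, hvf⟩ (hB e he f hf hef)

/-- The union of three disjoint finite matchings is `(7,2)`-edge-choosable. -/
theorem exists_coloring_of_three_matchings {V : Type*} [DecidableEq V]
    (A B X : Finset (Sym2 V)) (hAB : Disjoint A B) (hAX : Disjoint A X) (hBX : Disjoint B X)
    (hA : ∀ e ∈ A, ∀ f ∈ A, e ≠ f → ¬ EdgeIncident e f)
    (hB : ∀ e ∈ B, ∀ f ∈ B, e ≠ f → ¬ EdgeIncident e f)
    (hX : ∀ e ∈ X, ∀ f ∈ X, e ≠ f → ¬ EdgeIncident e f) (L : Sym2 V → Finset ℕ)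
    (hL : ∀ e ∈ A ∪ B ∪ X, (L e).card = 7) :
    ∃ C : Sym2 V → Finset ℕ, (∀ e ∈ A ∪ B ∪ X, C e ⊆ L e ∧ (C e).card = 2) ∧
      ∀ e ∈ A ∪ B ∪ X, ∀ f ∈ A ∪ B ∪ X, e ≠ f → EdgeIncident e f → Disjoint (C e) (C f) := by
  classical
  have hLA : ∀ e ∈ A, (L e).card = 7 := fun e he => hL e (by simp [he])
  have hLB : ∀ e ∈ B, (L e).card = 7 := fun e he => hL e (by simp [he])
  have hLX : ∀ e ∈ X, (L e).card = 7 := fun e he => hL e (by simp [he])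
  obtain ⟨a, haL, haA⟩ := exists_matching_selection X A hX hA L
    (fun x hx => Finset.card_pos.1 (by rw [hLX x hx]; norm_num))
    (fun x hx e he => by rw [hLX x hx, hLA e he])
  let N : (Sym2 V → ℕ) → Sym2 V → Finset ℕ := fun a e =>
    (X.filter fun x => EdgeIncident x e).image a
  have hN : ∀ a e, (N a e).card ≤ 2 := fun a e =>
    Finset.card_image_le.trans (card_filter_edgeIncident_le X hX e)
  have hmemN : ∀ a x e, x ∈ X → EdgeIncident x e → a x ∈ N a e := fun a x e hx h =>
    Finset.mem_image_of_mem _ (by simp [hx, h])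
  have hNle : ∀ (a : Sym2 V → ℕ) (M : Finset ℕ) (e : Sym2 V),
      (∀ x ∈ X, ∀ y ∈ X, EdgeIncident x e → EdgeIncident y e → a x ∈ M → a y ∈ M → a x = a y) →
      (M ∩ N a e).card ≤ 1 := by
    intro a M e h
    refine Finset.card_le_one.2 fun i hi j hj => ?_
    simp only [N, Finset.mem_inter, Finset.mem_image, Finset.mem_filter] at hi hj
    obtain ⟨hi, x, ⟨hx, hxe⟩, rfl⟩ := hi
    obtain ⟨hj, y, ⟨hy, hye⟩, rfl⟩ := hj
    exact h x hx y hy hxe hye hi hj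
  let L' : Sym2 V → Finset ℕ := fun e => if e ∈ X then (L e).erase (a e) else L e \ N a e
  have hL'X : ∀ x ∈ X, (L' x).card = 6 := fun x hx => by
    simp only [L', hx, if_true]
    rw [Finset.card_erase_of_mem (haL x hx), hLX x hx]
  let T := B.filter fun e => (L' e).card ≤ 6
  obtain ⟨b, hbL, hbT⟩ := exists_matching_selection X T hX
    (fun e he f hf => hB e (Finset.mem_filter.1 he).1 f (Finset.mem_filter.1 hf).1) L'
    (fun x hx => Finset.card_pos.1 (by rw [hL'X x hx]; norm_num))
    (fun x hx e he => by rw [hL'X x hx]; exact (Finset.mem_filter.1 he).2)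
  have hb : ∀ x ∈ X, b x ≠ a x ∧ b x ∈ L x := fun x hx => by
    have := hbL x hx
    simpa only [L', hx, if_true, Finset.mem_erase] using this
  have hM : ∀ e ∈ A ∪ B, 4 ≤ ((L e \ N a e) \ N b e).card := by
    intro e he
    have h₁ := Finset.card_sdiff_add_card_inter (L e) (N a e)
    have h₂ := Finset.card_sdiff_add_card_inter (L e \ N a e) (N b e)
    have h₃ := (Finset.card_le_card (Finset.inter_subset_right (s₁ := L e))).trans (hN a e)
    have h₄ := (Finset.card_le_card
      (Finset.inter_subset_right (s₁ := L e \ N a e))).trans (hN b e)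
    rcases Finset.mem_union.1 he with he | he
    · have h₅ := hNle a (L e) e (haA e he)
      have := hLA e he
      omega
    · have hL'e : L' e = L e \ N a e := by
        simp only [L', Finset.disjoint_left.1 hBX he, if_false]
      have := hLB e he
      by_cases hT : e ∈ T
      · have h₅ := hNle b (L' e) e (hbT e hT)
        rw [hL'e] at h₅
        omega
      · have h₅ : ¬ (L' e).card ≤ 6 := fun h => hT (Finset.mem_filter.2 ⟨he, h⟩)
        rw [hL'e] at h₅
        omega
  obtain ⟨C, hC, hCd⟩ := exists_coloring_of_two_matchings A B hAB hA hB _ hM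
  have hnX : ∀ e ∈ A ∪ B, e ∉ X := fun e he h => by
    rcases Finset.mem_union.1 he with he | he
    · exact Finset.disjoint_left.1 hAX he h
    · exact Finset.disjoint_left.1 hBX he h
  have key : ∀ x ∈ X, ∀ e ∈ A ∪ B, EdgeIncident x e → Disjoint {a x, b x} (C e) := by
    intro x hx e he hi
    have h₁ := (hC e he).1
    rw [Finset.disjoint_left]
    intro i hi' hiC
    have h₂ := h₁ hiC
    simp only [Finset.mem_sdiff] at h₂
    simp only [Finset.mem_insert, Finset.mem_singleton] at hi'
    rcases hi' with rfl | rfl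
    · exact h₂.1.2 (hmemN a x e hx hi)
    · exact h₂.2 (hmemN b x e hx hi)
  refine ⟨fun e => if e ∈ X then {a e, b e} else C e, fun e he => ?_,
    fun e he f hf hef hi => ?_⟩
  · rcases Finset.mem_union.1 he with he | he
    · simp only [hnX e he, if_false]
      exact ⟨(hC e he).1.trans (Finset.sdiff_subset.trans Finset.sdiff_subset), (hC e he).2⟩
    · simp only [he, if_true]
      refine ⟨?_, Finset.card_pair (hb e he).1.symm⟩
      simp [Finset.insert_subset_iff, haL e he, (hb e he).2]
  · rcases Finset.mem_union.1 he with he | he <;> rcases Finset.mem_union.1 hf with hf | hf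
    · simp only [hnX e he, hnX f hf, if_false]
      exact hCd e he f hf hef hi
    · simp only [hnX e he, hf, if_false, if_true]
      exact (key f hf e he hi.symm).symm
    · simp only [he, hnX f hf, if_false, if_true]
      exact key e he f hf hi
    · exact absurd hi (hX e he f hf hef)

/-- Every graph admitting a proper 3-edge-coloring is `(7,2)`-edge-choosable. -/
theorem stmt2 {V : Type*} (G : SimpleGraph V)
    (h3 : ∃ c : Sym2 V → Fin 3,
      ∀ e ∈ G.edgeSet, ∀ f ∈ G.edgeSet, e ≠ f → EdgeIncident e f → c e ≠ c f) :
    EdgeChoosable G 7 2 := by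
  classical
  obtain ⟨c, hc⟩ := h3
  intro L hL
  have hfin : ∀ F : Finset (Sym2 V), ∃ C : (e : Sym2 V) → (L e).powerset,
      (↑F ⊆ G.edgeSet → (∀ e ∈ F, (C e : Finset ℕ).card = 2) ∧
        ∀ e ∈ F, ∀ f ∈ F, e ≠ f → EdgeIncident e f →
          Disjoint (C e : Finset ℕ) (C f : Finset ℕ)) := by
    intro F
    by_cases hF : ↑F ⊆ G.edgeSet
    · have hmatch : ∀ i, ∀ e ∈ F.filter (c · = i), ∀ f ∈ F.filter (c · = i), e ≠ f →
          ¬ EdgeIncident e f := by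
        intro i e he f hf hef hinc
        rw [Finset.mem_filter] at he hf
        exact hc e (hF he.1) f (hF hf.1) hef hinc (he.2.trans hf.2.symm)
      have hdisj : ∀ i j, i ≠ j → Disjoint (F.filter (c · = i)) (F.filter (c · = j)) := by
        intro i j hij
        exact Finset.disjoint_filter.2 fun e _ h h' => hij (h.symm.trans h')
      have hunion : F.filter (c · = 0) ∪ F.filter (c · = 1) ∪ F.filter (c · = 2) = F := by
        ext e
        have : c e = 0 ∨ c e = 1 ∨ c e = 2 := by
          generalize c e = i
          fin_cases i <;> simp
        simp only [Finset.mem_union, Finset.mem_filter]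
        tauto
      obtain ⟨C, hC, hCd⟩ := exists_coloring_of_three_matchings _ _ _
        (hdisj 0 1 (by decide)) (hdisj 0 2 (by decide)) (hdisj 1 2 (by decide))
        (hmatch 0) (hmatch 1) (hmatch 2) L (by
          rw [hunion]
          exact fun e he => hL e (hF he))
      rw [hunion] at hC hCd
      have hCL : ∀ e ∈ F, L e ∩ C e = C e := fun e he =>
        Finset.inter_eq_right.2 (hC e he).1
      refine ⟨fun e => ⟨L e ∩ C e, by simp⟩, fun _ => ⟨fun e he => ?_, fun e he f hf hef hinc => ?_⟩⟩
      · simpa only [hCL e he] using (hC e he).2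
      · simpa only [hCL e he, hCL f hf] using hCd e he f hf hef hinc
    · exact ⟨fun e => ⟨∅, by simp⟩, fun h => absurd h hF⟩
  have hfin' : ∀ F : Finset (Sym2 V), ∃ C : (e : Sym2 V) → (L e).powerset,
      (∀ e ∈ F, e ∈ G.edgeSet → (C e : Finset ℕ).card = 2) ∧
        ∀ e ∈ F, ∀ f ∈ F, e ∈ G.edgeSet → f ∈ G.edgeSet → e ≠ f → EdgeIncident e f →
          Disjoint (C e : Finset ℕ) (C f : Finset ℕ) := by
    intro F
    obtain ⟨C, hC⟩ := hfin (F.filter (· ∈ G.edgeSet))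
    obtain ⟨h₁, h₂⟩ := hC fun e he => (Finset.mem_filter.1 he).2
    exact ⟨C, fun e he heG => h₁ e (Finset.mem_filter.2 ⟨he, heG⟩), fun e he f hf heG hfG =>
      h₂ e (Finset.mem_filter.2 ⟨he, heG⟩) f (Finset.mem_filter.2 ⟨hf, hfG⟩)⟩
  choose g hg₁ hg₂ using hfin'
  obtain ⟨χ, hχ⟩ := Finset.rado_selection g
  refine ⟨fun e => χ e, fun e he => ⟨Finset.mem_powerset.1 (χ e).2, ?_⟩,
    fun e he f hf hef hinc => ?_⟩
  · obtain ⟨t, hst, ht⟩ := hχ {e}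
    dsimp only
    rw [ht e (by simp)]
    exact hg₁ t e (hst (by simp)) he
  · obtain ⟨t, hst, ht⟩ := hχ {e, f}
    dsimp only
    rw [ht e (by simp), ht f (by simp)]
    exact hg₂ t e (hst (by simp)) f (hst (by simp)) he hf hef hinc
end

section
/- If $G$ is a 3-edge-colorable graph and $m$ is a positive integer, then $G$ is $(\lceil 7m/2 \rceil, m)$-edge-choosable. -/
/-- Values can be propagated along the iterates of a map `p`, starting from the set `B`. -/
lemma exists_propagation {W α : Type*} (p : W → W) (B : Set W) (s : W → α) (F : W → α → α) :
    ∃ f : W → α, (∀ v ∈ B, f v = s v) ∧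
      ∀ v ∉ B, (∃ n, p^[n] v ∈ B) → f v = F v (f (p v)) := by
  classical
  let val : ℕ → W → α := fun n => Nat.rec s (fun _ g v => F v (g (p v))) n
  refine ⟨fun v => if h : ∃ n, p^[n] v ∈ B then val (Nat.find h) v else s v, ?_, ?_⟩
  · intro v hv
    have h : ∃ n, p^[n] v ∈ B := ⟨0, hv⟩
    have h0 : Nat.find h = 0 := (Nat.find_eq_zero h).2 hv
    simp only [dif_pos h, h0]
    rfl
  · intro v hv h
    have h' : ∃ n, p^[n] (p v) ∈ B := by
      obtain ⟨n, hn⟩ := h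
      cases n with
      | zero => exact absurd hn hv
      | succ n => exact ⟨n, hn⟩
    have h1 : Nat.find h = Nat.find h' + 1 := Nat.find_comp_succ h h' hv
    simp only [dif_pos h, dif_pos h', h1]
    rfl

/-- Every set of vertices of a properly 2-coloured functional digraph has a kernel. -/
lemma exists_kernel_s16 {W : Type*} (g : W → W) (b : W → Bool) (hb : ∀ w, b (g w) = !b w)
    (S : Set W) : ∃ I ⊆ S, ∀ w ∈ S, w ∈ I ↔ g w ∉ I := by
  classical
  obtain ⟨f, hf0, hf1⟩ := exists_propagation g Sᶜ (fun _ => false) (fun _ x => !x)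
  refine ⟨{w | w ∈ S ∧ if ∃ n, g^[n] w ∈ Sᶜ then f w = true else b w = true},
    fun w hw => hw.1, fun w hw => ?_⟩
  have hw' : w ∉ Sᶜ := fun h => h hw
  by_cases h : ∃ n, g^[n] w ∈ Sᶜ
  · have h' : ∃ n, g^[n] (g w) ∈ Sᶜ := by
      obtain ⟨n, hn⟩ := h
      cases n with
      | zero => exact absurd hn hw'
      | succ n => exact ⟨n, hn⟩
    have h1 := hf1 w hw' h
    by_cases hg : g w ∈ S
    · simp only [Set.mem_ofPred_eq, hw, hg, true_and, if_pos h, if_pos h', h1]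
      cases f (g w) <;> simp
    · have := hf0 (g w) hg
      simp only [Set.mem_ofPred_eq, hw, hg, true_and, false_and, if_pos h, h1, this]
      simp
  · have h' : ¬ ∃ n, g^[n] (g w) ∈ Sᶜ := fun ⟨n, hn⟩ => h ⟨n + 1, hn⟩
    have hg : g w ∈ S := by
      by_contra hg
      exact h ⟨1, hg⟩
    simp only [Set.mem_ofPred_eq, hw, hg, true_and, if_neg h, if_neg h', hb]
    cases b w <;> simp

/-- Properly 2-coloured functional digraphs are `(2m, m)`-choosable. -/
lemma exists_disjoint_selection {W : Type*} (g : W → W) (b : W → Bool)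
    (hb : ∀ w, b (g w) = !b w) (m : ℕ) (A : W → Finset ℕ) (hA : ∀ w, 2 * m ≤ (A w).card) :
    ∃ C : W → Finset ℕ, ∀ w, C w ⊆ A w ∧ (C w).card = m ∧ Disjoint (C w) (C (g w)) := by
  classical
  choose K hKS hK using exists_kernel_s16 g b hb
  let C : ℕ → W → Finset ℕ := fun t => Nat.rec (fun _ => ∅)
    (fun t D w => if w ∈ K {w | t ∈ A w ∧ (D w).card < m} then insert t (D w) else D w) t
  have hC : ∀ t w, C (t + 1) w =
      if w ∈ K {w | t ∈ A w ∧ (C t w).card < m} then insert t (C t w) else C t w :=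
    fun _ _ => rfl
  have hmono : ∀ w, Monotone (fun t => C t w) := fun w => monotone_nat_of_le_succ fun t => by
    simp only [hC]
    split_ifs
    · exact Finset.subset_insert _ _
    · exact le_rfl
  have inv : ∀ t, (∀ w, C t w ⊆ A w ∧ (∀ a ∈ C t w, a < t) ∧ (C t w).card ≤ m ∧
      Disjoint (C t w) (C t (g w)) ∧
      ((C t w).card < m →
        2 * m ≤ ((A w).filter (t ≤ ·)).card + (C t w).card + (C t (g w)).card)) := by
    intro t
    induction t with
    | zero =>
      intro w
      refine ⟨Finset.empty_subset _, fun a ha => absurd ha (Finset.notMem_empty a),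
        Nat.zero_le _, Finset.disjoint_empty_left _, fun _ => ?_⟩
      have := hA w
      simp only [Nat.zero_le, Finset.filter_true]
      omega
    | succ t ih =>
      set S : Set W := {w | t ∈ A w ∧ (C t w).card < m} with hS
      intro w
      have hnot : ∀ w, t ∉ C t w := fun w h => lt_irrefl _ ((ih w).2.1 t h)
      have hin : ∀ w ∈ K S, C (t + 1) w = insert t (C t w) := fun w h => by rw [hC, if_pos h]
      have hout : ∀ w ∉ K S, C (t + 1) w = C t w := fun w h => by rw [hC, if_neg h]
      have hcin : ∀ w ∈ K S, (C (t + 1) w).card = (C t w).card + 1 := fun w h => by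
        rw [hin w h, Finset.card_insert_of_notMem (hnot w)]
      have hcle : ∀ w, (C t w).card ≤ (C (t + 1) w).card := fun w =>
        Finset.card_le_card (hmono w (Nat.le_succ t))
      obtain ⟨h1, h2, h3, h4, h5⟩ := ih w
      refine ⟨?_, ?_, ?_, ?_, ?_⟩
      · by_cases h : w ∈ K S
        · rw [hin w h]
          exact Finset.insert_subset (hKS S h).1 h1
        · rwa [hout w h]
      · intro a ha
        by_cases h : w ∈ K S
        · rw [hin w h, Finset.mem_insert] at ha
          rcases ha with rfl | ha
          · exact Nat.lt_succ_self _
          · exact Nat.lt_succ_of_lt (h2 a ha)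
        · rw [hout w h] at ha
          exact Nat.lt_succ_of_lt (h2 a ha)
      · by_cases h : w ∈ K S
        · rw [hcin w h]
          exact (hKS S h).2
        · rwa [hout w h]
      · by_cases h : w ∈ K S
        · have hg := (hK S w (hKS S h)).1 h
          rw [hin w h, hout _ hg, Finset.disjoint_insert_left]
          exact ⟨hnot _, h4⟩
        · rw [hout w h]
          by_cases hg : g w ∈ K S
          · rw [hin _ hg, Finset.disjoint_insert_right]
            exact ⟨hnot _, h4⟩
          · rwa [hout _ hg]
      · intro hlt
        have hlt' : (C t w).card < m := (hcle w).trans_lt hlt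
        have h6 := h5 hlt'
        have hgle := hcle (g w)
        by_cases ht : t ∈ A w
        · have hwS : w ∈ S := ⟨ht, hlt'⟩
          have hfil : ((A w).filter (t ≤ ·)).card ≤ ((A w).filter (t + 1 ≤ ·)).card + 1 := by
            rw [← Finset.card_insert_of_notMem (a := t) (by simp)]
            refine Finset.card_le_card fun a ha => ?_
            simp only [Finset.mem_filter, Finset.mem_insert] at ha ⊢
            rcases ha.2.eq_or_lt with h | h
            · exact Or.inl h.symm
            · exact Or.inr ⟨ha.1, h⟩
          by_cases h : w ∈ K S
          · have := hcin w h
            omega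
          · have hg : g w ∈ K S := by
              by_contra hg
              exact h ((hK S w hwS).2 hg)
            have := hcin _ hg
            have := hcle w
            omega
        · have hfil : (A w).filter (t ≤ ·) = (A w).filter (t + 1 ≤ ·) := by
            refine Finset.filter_congr fun a ha => ?_
            have : a ≠ t := fun h => ht (h ▸ ha)
            omega
          have := hcle w
          rw [← hfil]
          omega
  let T : W → ℕ := fun w => (A w).sup id + 1
  refine ⟨fun w => C (T w) w, fun w => ⟨(inv (T w) w).1, ?_, ?_⟩⟩
  · by_contra hne
    obtain ⟨-, -, h3, -, h5⟩ := inv (T w) w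
    have h6 := h5 (lt_of_le_of_ne h3 hne)
    have hemp : (A w).filter (T w ≤ ·) = ∅ := by
      refine Finset.filter_eq_empty_iff.2 fun a ha => ?_
      have : a ≤ (A w).sup id := Finset.le_sup (f := id) ha
      simp only [T]
      omega
    have := (inv (T w) (g w)).2.2.1
    rw [hemp, Finset.card_empty] at h6
    dsimp only at hne
    omega
  · exact ((inv (max (T w) (T (g w))) w).2.2.2.1).mono
      (hmono w (le_max_left (T w) (T (g w)))) (hmono (g w) (le_max_right (T w) (T (g w))))

/-- Along a permutation one can pick one colour per point so that the two colours at the ends of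
every edge `{w, g w}` coincide or do not both lie in the list of that edge. -/
lemma exists_saving_color {W : Type*} (g : Equiv.Perm W) (A E : W → Finset ℕ) (N : ℕ)
    (hN : 0 < N) (hA : ∀ w, (A w).card = N) (hE : ∀ w, (E w).card = N) :
    ∃ f : W → ℕ, ∀ w, f w ∈ A w ∧ (f w = f (g w) ∨ f w ∉ E w ∨ f (g w) ∉ E w) := by
  classical
  have step : ∀ (X Y : Finset ℕ), X.card = N → Y.card = N → ∀ x : ℕ, ∃ y ∈ X,
      x = y ∨ x ∉ Y ∨ y ∉ Y := by
    intro X Y hX hY x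
    by_cases hx : x ∈ X
    · exact ⟨x, hx, Or.inl rfl⟩
    by_cases hxY : x ∈ Y
    · by_contra! hcon
      have hsub : X ⊆ Y := fun y hy => (hcon y hy).2.2
      have := Finset.eq_of_subset_of_card_le hsub (by omega)
      exact hx (this ▸ hxY)
    · obtain ⟨y, hy⟩ := Finset.card_pos.1 (hX ▸ hN)
      exact ⟨y, hy, Or.inr (Or.inl hxY)⟩
  have pick : ∀ X Y : Finset ℕ, X.card = N → ∃ y ∈ X, ¬ X ⊆ Y → y ∉ Y := by
    intro X Y hX
    by_cases h : X ⊆ Y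
    · obtain ⟨y, hy⟩ := Finset.card_pos.1 (hX ▸ hN)
      exact ⟨y, hy, fun h' => absurd h h'⟩
    · obtain ⟨y, hy, hy'⟩ := Finset.not_subset.1 h
      exact ⟨y, hy, fun _ => hy'⟩
  choose F hFA hF using fun w x => step (A w) (E (g.symm w)) (hA _) (hE _) x
  choose F' hFA' hF' using fun w x => step (A w) (E w) (hA _) (hE _) x
  choose s hsA hs using fun w => pick (A w) (E (g.symm w)) (hA _)
  choose s' hsA' hs' using fun w => pick (A w) (E w) (hA _)
  let B : Set W := {w | ¬ A w ⊆ E (g.symm w)}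
  let B' : Set W := {w | ¬ A w ⊆ E w}
  obtain ⟨f₁, hf₁, hf₁'⟩ := exists_propagation g.symm B s F
  obtain ⟨f₂, hf₂, hf₂'⟩ := exists_propagation g B' s' F'
  have hne : ∀ w, (A w).Nonempty := fun w => Finset.card_pos.1 (hA w ▸ hN)
  let μ : W → ℕ := fun w => (A w).min' (hne w)
  let P : W → Prop := fun w => ∃ n, g.symm^[n] w ∈ B
  let Q : W → Prop := fun w => ∃ n, g^[n] w ∈ B'
  have hPB : ∀ w, w ∈ B → P w := fun w h => ⟨0, h⟩
  have hQB : ∀ w, w ∈ B' → Q w := fun w h => ⟨0, h⟩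
  have hPs : ∀ w, P w → P (g w) := fun w ⟨n, hn⟩ => ⟨n + 1, by
    rwa [Function.iterate_succ_apply, Equiv.symm_apply_apply]⟩
  have hPs' : ∀ w, P (g w) → g w ∉ B → P w := by
    rintro w ⟨n, hn⟩ h
    cases n with
    | zero => exact absurd hn h
    | succ n =>
      rw [Function.iterate_succ_apply, Equiv.symm_apply_apply] at hn
      exact ⟨n, hn⟩
  have hQs : ∀ w, Q (g w) → Q w := fun w ⟨n, hn⟩ => ⟨n + 1, hn⟩
  have hQs' : ∀ w, Q w → w ∉ B' → Q (g w) := by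
    rintro w ⟨n, hn⟩ h
    cases n with
    | zero => exact absurd hn h
    | succ n => exact ⟨n, hn⟩
  have hA₁ : ∀ w, P w → f₁ w ∈ A w := by
    intro w hw
    by_cases h : w ∈ B
    · rw [hf₁ w h]; exact hsA w
    · rw [hf₁' w h hw]; exact hFA _ _
  have hA₂ : ∀ w, Q w → f₂ w ∈ A w := by
    intro w hw
    by_cases h : w ∈ B'
    · rw [hf₂ w h]; exact hsA' w
    · rw [hf₂' w h hw]; exact hFA' _ _
  let f : W → ℕ := fun w => if P w then f₁ w else if Q w then f₂ w else μ w
  have hfB : ∀ w, g w ∈ B → f (g w) ∉ E w := by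
    intro w h
    have h1 : f (g w) = s (g w) := by
      simp only [f, if_pos (hPB _ h), hf₁ _ h]
    rw [h1]
    simpa using hs (g w) h
  refine ⟨f, fun w => ⟨?_, ?_⟩⟩
  · by_cases hP : P w
    · simp only [f, if_pos hP]; exact hA₁ w hP
    by_cases hQ : Q w
    · simp only [f, if_neg hP, if_pos hQ]; exact hA₂ w hQ
    · simp only [f, if_neg hP, if_neg hQ]; exact Finset.min'_mem _ _
  · by_cases hB : g w ∈ B
    · exact Or.inr (Or.inr (hfB w hB))
    by_cases hP : P w
    · have hP' := hPs w hP
      have h1 : f w = f₁ w := by simp only [f, if_pos hP]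
      have h2 : f (g w) = F (g w) (f₁ w) := by
        simp only [f, if_pos hP', hf₁' _ hB hP', Equiv.symm_apply_apply]
      rw [h1, h2]
      simpa using hF (g w) (f₁ w)
    have hP' : ¬ P (g w) := fun h => hP (hPs' w h hB)
    by_cases hB' : w ∈ B'
    · have h1 : f w = s' w := by
        simp only [f, if_neg hP, if_pos (hQB _ hB'), hf₂ _ hB']
      exact Or.inr (Or.inl (h1 ▸ hs' w hB'))
    by_cases hQ : Q w
    · have hQ' := hQs' w hQ hB'
      have h1 : f w = F' w (f₂ (g w)) := by
        simp only [f, if_neg hP, if_pos hQ, hf₂' _ hB' hQ]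
      have h2 : f (g w) = f₂ (g w) := by
        simp only [f, if_neg hP', if_pos hQ']
      rw [h1, h2]
      rcases hF' w (f₂ (g w)) with h | h | h
      · exact Or.inl h.symm
      · exact Or.inr (Or.inr h)
      · exact Or.inr (Or.inl h)
    · have hQ' : ¬ Q (g w) := fun h => hQ (hQs w h)
      have e1 : A w = E w :=
        Finset.eq_of_subset_of_card_le (not_not.1 hB') (by rw [hA, hE])
      have e2 : A (g w) = E w := by
        have h : A (g w) ⊆ E (g.symm (g w)) := not_not.1 hB
        rw [Equiv.symm_apply_apply] at h
        exact Finset.eq_of_subset_of_card_le h (by rw [hA, hE])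
      left
      simp only [f, if_neg hP, if_neg hP', if_neg hQ, if_neg hQ', μ, e1, e2]

/-- The number of colours of `X` and `Y`, counted separately, that are not lost by the list `E`
when the colours in `X ∪ Y` are removed from it. -/
def savings (E X Y : Finset ℕ) : ℕ := (X \ E).card + (Y \ E).card + (X ∩ Y ∩ E).card

lemma savings_mono (E : Finset ℕ) {X X' Y Y' : Finset ℕ} (hX : X ⊆ X') (hY : Y ⊆ Y') :
    savings E X Y ≤ savings E X' Y' := by
  unfold savings
  gcongr

lemma card_inter_union_add_savings (E X Y : Finset ℕ) :
    (E ∩ (X ∪ Y)).card + savings E X Y = X.card + Y.card := by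
  have h1 := Finset.card_sdiff_add_card_inter X E
  have h2 := Finset.card_sdiff_add_card_inter Y E
  have h3 := Finset.card_union_add_card_inter (X ∩ E) (Y ∩ E)
  have h4 : X ∩ E ∪ Y ∩ E = E ∩ (X ∪ Y) := by
    rw [← Finset.union_inter_distrib_right, Finset.inter_comm]
  have h5 : X ∩ E ∩ (Y ∩ E) = X ∩ Y ∩ E := (Finset.inter_inter_distrib_right X Y E).symm
  rw [h4, h5] at h3
  unfold savings
  omega

lemma savings_comm (E X Y : Finset ℕ) : savings E X Y = savings E Y X := by
  unfold savings
  rw [Finset.inter_comm X Y]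
  omega

lemma savings_insert_left {E X : Finset ℕ} (Y : Finset ℕ) {x : ℕ} (hE : x ∉ E) (hX : x ∉ X) :
    savings E (insert x X) Y = savings E X Y + 1 := by
  have h : insert x X ∩ Y ∩ E = X ∩ Y ∩ E := by
    ext a
    simp only [Finset.mem_inter, Finset.mem_insert]
    grind
  unfold savings
  rw [h, Finset.insert_sdiff_of_notMem _ hE, Finset.card_insert_of_notMem (by simp [hX])]
  omega

lemma savings_insert_right {E Y : Finset ℕ} (X : Finset ℕ) {y : ℕ} (hE : y ∉ E) (hY : y ∉ Y) :
    savings E X (insert y Y) = savings E X Y + 1 := by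
  rw [savings_comm, savings_insert_left X hE hY, savings_comm]

lemma savings_erase {E : Finset ℕ} {e : ℕ} (he : e ∈ E) (X Y : Finset ℕ) :
    savings (E.erase e) X Y + (if e ∈ X ∩ Y then 1 else 0) =
      savings E X Y + (if e ∈ X then 1 else 0) + (if e ∈ Y then 1 else 0) := by
  have h1 : ∀ S : Finset ℕ, (S ∩ E).card = (S ∩ E.erase e).card + if e ∈ S then 1 else 0 := by
    intro S
    rw [← Finset.erase_inter_comm, Finset.erase_inter]
    split_ifs with h
    · rw [Finset.card_erase_add_one (Finset.mem_inter.2 ⟨h, he⟩)]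
    · rw [Finset.erase_eq_of_notMem fun h' => h (Finset.mem_inter.1 h').1, Nat.add_zero]
  have h2 := h1 X
  have h3 := h1 Y
  have h4 := h1 (X ∩ Y)
  have h5 := Finset.card_sdiff_add_card_inter X E
  have h6 := Finset.card_sdiff_add_card_inter Y E
  have h7 := Finset.card_sdiff_add_card_inter X (E.erase e)
  have h8 := Finset.card_sdiff_add_card_inter Y (E.erase e)
  unfold savings
  omega

lemma exists_erase_savings_insert {E : Finset ℕ} {x y : ℕ} (hE : E.Nonempty)
    (h : x = y ∨ x ∉ E ∨ y ∉ E) :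
    ∃ e ∈ E, ∀ X Y : Finset ℕ, x ∉ X → y ∉ Y →
      savings (E.erase e) X Y + 1 ≤ savings E (insert x X) (insert y Y) := by
  by_cases hx : x ∈ E
  · refine ⟨x, hx, fun X Y hX hY => ?_⟩
    have hx' : x ∉ E.erase x := Finset.notMem_erase _ _
    have h1 := savings_erase hx (insert x X) (insert y Y)
    rw [savings_insert_left _ hx' hX] at h1
    by_cases hxy : x = y
    · subst hxy
      rw [savings_insert_right _ hx' hY] at h1
      simp only [Finset.mem_inter, Finset.mem_insert_self, and_self, if_true] at h1
      omega
    · have hy : y ∉ E := by tauto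
      rw [savings_insert_right _ (fun h => hy (Finset.mem_of_mem_erase h)) hY] at h1
      simp only [Finset.mem_inter, Finset.mem_insert_self, true_and, if_true] at h1
      omega
  · by_cases hy : y ∈ E
    · refine ⟨y, hy, fun X Y hX hY => ?_⟩
      have h1 := savings_erase hy X (insert y Y)
      rw [savings_insert_right _ (Finset.notMem_erase _ _) hY] at h1
      simp only [Finset.mem_inter, Finset.mem_insert_self, and_true, if_true] at h1
      rw [savings_insert_left _ hx hX]
      omega
    · obtain ⟨e, he⟩ := hE
      refine ⟨e, he, fun X Y hX hY => ?_⟩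
      have h1 := savings_erase he X Y
      rw [savings_insert_left _ hx hX, savings_insert_right _ hy hY]
      simp only [Finset.mem_inter] at h1
      split_ifs at h1 <;> first | omega | tauto

lemma exists_saving_selection {W : Type*} (g : Equiv.Perm W) (k : ℕ) :
    ∀ (A E : W → Finset ℕ) (N : ℕ), k ≤ N → (∀ w, (A w).card = N) → (∀ w, (E w).card = N) →
    ∃ D : W → Finset ℕ, ∀ w, D w ⊆ A w ∧ (D w).card = k ∧ k ≤ savings (E w) (D w) (D (g w)) := by
  induction k with
  | zero => exact fun A E N _ _ _ => ⟨fun _ => ∅, fun w => by simp⟩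
  | succ k ih =>
    intro A E N hk hA hE
    obtain ⟨f, hf⟩ := exists_saving_color g A E N (by omega) hA hE
    choose e he hsav using fun w =>
      exists_erase_savings_insert (Finset.card_pos.1 (by rw [hE w]; omega)) (hf w).2
    obtain ⟨D, hD⟩ := ih (fun w => (A w).erase (f w)) (fun w => (E w).erase (e w)) (N - 1)
      (by omega) (fun w => by rw [Finset.card_erase_of_mem (hf w).1, hA])
      (fun w => by rw [Finset.card_erase_of_mem (he w), hE])
    have hnot : ∀ w, f w ∉ D w := fun w h => Finset.notMem_erase _ _ ((hD w).1 h)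
    refine ⟨fun w => insert (f w) (D w), fun w => ⟨?_, ?_, ?_⟩⟩
    · exact Finset.insert_subset (hf w).1 ((hD w).1.trans (Finset.erase_subset _ _))
    · rw [Finset.card_insert_of_notMem (hnot w), (hD w).2.1]
    · have := hsav w (D w) (D (g w)) (hnot w) (hnot (g w))
      exact (Nat.succ_le_succ (hD w).2.2).trans this

/-- A fixed-point-free involution swaps the classes of some 2-colouring. -/
lemma Function.Involutive.exists_bool_coloring {Q : Type*} {s : Q → Q}
    (hs : Function.Involutive s) (hfix : ∀ q, s q ≠ q) : ∃ b : Q → Bool, ∀ q, b (s q) = !b q := by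
  classical
  let _ : LinearOrder Q := linearOrderOfSTO WellOrderingRel
  refine ⟨fun q => decide (q < s q), fun q => ?_⟩
  dsimp only
  rw [hs q]
  rcases lt_trichotomy q (s q) with h | h | h
  · simp [h, h.le]
  · exact absurd h.symm (hfix q)
  · simp [h, h.le]

/-- Two fixed-point-free involutions have a common proper 2-colouring. -/
lemma exists_common_bool_coloring {W : Type*} {σ τ : Equiv.Perm W} (hσ : Function.Involutive σ)
    (hτ : Function.Involutive τ) (hσ' : ∀ w, σ w ≠ w) (hτ' : ∀ w, τ w ≠ w) :
    ∃ b : W → Bool, (∀ w, b (σ w) = !b w) ∧ ∀ w, b (τ w) = !b w := by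
  have hconj : ∀ (j : ℤ) (w : W), σ (((σ * τ) ^ j) w) = ((σ * τ) ^ (-j)) (σ w) := by
    have h1 : σ * (σ * τ) * σ⁻¹ = (σ * τ)⁻¹ := by
      have e1 : σ * σ = 1 := Equiv.ext hσ
      have e2 : τ * τ = 1 := Equiv.ext hτ
      rw [mul_inv_rev, ← mul_assoc, e1, one_mul, inv_eq_of_mul_eq_one_right e2]
    intro j w
    have h2 : σ * (σ * τ) ^ j * σ⁻¹ = (σ * τ) ^ (-j) := by
      rw [← conj_zpow, h1, inv_zpow, zpow_neg]
    rw [← h2]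
    simp
  have hcyc : ∀ w, ¬ (σ * τ).SameCycle w (σ w) := by
    rintro w ⟨i, hi⟩
    obtain ⟨j, rfl | rfl⟩ := i.even_or_odd'
    · apply hσ' (((σ * τ) ^ j) w)
      rw [hconj, ← hi, ← Equiv.Perm.mul_apply, ← zpow_add]
      congr 2
      ring
    · apply hτ' (((σ * τ) ^ j) w)
      apply σ.injective
      rw [hconj, ← hi, ← Equiv.Perm.mul_apply, ← Equiv.Perm.mul_apply, ← Equiv.Perm.mul_apply,
        ← zpow_one_add, ← zpow_add]
      congr 2
      ring
  let S := Equiv.Perm.SameCycle.setoid (σ * τ)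
  have hmap : ∀ a c, S a c → S (σ a) (σ c) := by
    rintro a c ⟨i, rfl⟩
    exact ⟨-i, (hconj i a).symm⟩
  let s : Quotient S → Quotient S := Quotient.map σ hmap
  have hs : Function.Involutive s := by
    rintro ⟨w⟩
    exact congrArg (Quotient.mk S) (hσ w)
  have hfix : ∀ q, s q ≠ q := by
    rintro ⟨w⟩ h
    exact hcyc w (Quotient.exact h.symm)
  obtain ⟨b, hb⟩ := hs.exists_bool_coloring hfix
  have hbσ : ∀ w, b (Quotient.mk S (σ w)) = !b (Quotient.mk S w) := fun w => hb (Quotient.mk S w)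
  refine ⟨fun w => b (Quotient.mk S w), hbσ, fun w => ?_⟩
  have h1 : Quotient.mk S w = Quotient.mk S (σ (τ w)) := Quotient.sound ⟨1, by simp⟩
  dsimp only
  rw [h1, hbσ, Bool.not_not]

/-- The choosability theorem for a 3-regular (multi)graph whose three colour classes are perfect
matchings, encoded as involutions of the vertex set. -/
lemma exists_selection_of_involutions {W : Type*} {σ τ ρ : W → W}
    (hσ : Function.Involutive σ) (hτ : Function.Involutive τ) (hρ : Function.Involutive ρ)
    (hσ' : ∀ w, σ w ≠ w) (hτ' : ∀ w, τ w ≠ w) (m : ℕ) (P Q R : W → Finset ℕ)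
    (hP : ∀ w, P (σ w) = P w) (hQ : ∀ w, Q (τ w) = Q w) (hR : ∀ w, R (ρ w) = R w)
    (hPc : ∀ w, (P w).card = (7 * m + 1) / 2) (hQc : ∀ w, (Q w).card = (7 * m + 1) / 2)
    (hRc : ∀ w, (R w).card = (7 * m + 1) / 2) :
    ∃ X Y Z : W → Finset ℕ,
      (∀ w, X (σ w) = X w) ∧ (∀ w, Y (τ w) = Y w) ∧ (∀ w, Z (ρ w) = Z w) ∧
      (∀ w, X w ⊆ P w ∧ (X w).card = m) ∧ (∀ w, Y w ⊆ Q w ∧ (Y w).card = m) ∧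
      (∀ w, Z w ⊆ R w ∧ (Z w).card = m) ∧
      ∀ w, Disjoint (X w) (Y w) ∧ Disjoint (X w) (Z w) ∧ Disjoint (Y w) (Z w) := by
  classical
  obtain ⟨b, hbσ, hbτ⟩ := exists_common_bool_coloring (σ := hσ.toPerm) (τ := hτ.toPerm)
    hσ hτ hσ' hτ'
  simp only [Function.Involutive.coe_toPerm] at hbσ hbτ
  let g : Equiv.Perm W :=
    { toFun := fun w => if b w then σ w else τ w
      invFun := fun w => if b w then τ w else σ w
      left_inv := fun w => by
        cases h : b w <;> simp [h, hbσ, hbτ, hσ w, hτ w]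
      right_inv := fun w => by
        cases h : b w <;> simp [h, hbσ, hbτ, hσ w, hτ w] }
  have hgt : ∀ w, b w = true → g w = σ w := fun w h => if_pos h
  have hgf : ∀ w, b w = false → g w = τ w := fun w h => if_neg (by simp [h])
  have hbg : ∀ w, b (g w) = !b w := fun w => by
    cases h : b w
    · rw [hgf w h, hbτ, h]
    · rw [hgt w h, hbσ, h]
  let E : W → Finset ℕ := fun w => if b w then P w else Q w
  have hEt : ∀ w, b w = true → E w = P w := fun w h => if_pos h
  have hEf : ∀ w, b w = false → E w = Q w := fun w h => if_neg (by simp [h])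
  have hEc : ∀ w, (E w).card = (7 * m + 1) / 2 := fun w => by
    cases h : b w
    · rw [hEf w h, hQc]
    · rw [hEt w h, hPc]
  obtain ⟨D, hD⟩ := exists_saving_selection g (m / 2) R E _ (by omega) hRc hEc
  have hext : ∀ S T : Finset ℕ, ∃ U : Finset ℕ,
      S ⊆ T → S.card ≤ m → m ≤ T.card → S ⊆ U ∧ U ⊆ T ∧ U.card = m := fun S T => by
    by_cases h : S ⊆ T ∧ S.card ≤ m ∧ m ≤ T.card
    · obtain ⟨U, hU⟩ := Finset.exists_subsuperset_card_eq h.1 h.2.1 h.2.2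
      exact ⟨U, fun _ _ _ => hU⟩
    · exact ⟨∅, fun h1 h2 h3 => absurd ⟨h1, h2, h3⟩ h⟩
  choose U hU using hext
  let Z : W → Finset ℕ := fun w => U (D w ∪ D (ρ w)) (R w)
  have hZ : ∀ w, D w ∪ D (ρ w) ⊆ Z w ∧ Z w ⊆ R w ∧ (Z w).card = m := fun w => by
    apply hU
    · refine Finset.union_subset (hD w).1 ?_
      rw [← hR w]
      exact (hD (ρ w)).1
    · have := Finset.card_union_le (D w) (D (ρ w))
      rw [(hD w).2.1, (hD (ρ w)).2.1] at this
      omega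
    · rw [hRc]
      omega
  have hZρ : ∀ w, Z (ρ w) = Z w := fun w => by
    simp only [Z, hρ w, hR, Finset.union_comm]
  have hcard : ∀ w, 2 * m ≤ (E w \ (Z w ∪ Z (g w))).card := fun w => by
    have h1 := card_inter_union_add_savings (E w) (Z w) (Z (g w))
    have h2 : savings (E w) (D w) (D (g w)) ≤ savings (E w) (Z w) (Z (g w)) :=
      savings_mono _ (Finset.union_subset_left (hZ w).1) (Finset.union_subset_left (hZ (g w)).1)
    have h3 := (hD w).2.2
    have h4 := Finset.card_sdiff_add_card_inter (E w) (Z w ∪ Z (g w))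
    rw [hEc] at h4
    rw [(hZ w).2.2, (hZ (g w)).2.2] at h1
    omega
  obtain ⟨C, hC⟩ := exists_disjoint_selection g b hbg m _ hcard
  have hCE : ∀ w, C w ⊆ E w := fun w => (hC w).1.trans Finset.sdiff_subset
  have hCZ : ∀ w, Disjoint (C w) (Z w) := fun w =>
    Finset.disjoint_of_subset_left (hC w).1
      (Finset.disjoint_of_subset_right Finset.subset_union_left Finset.sdiff_disjoint)
  have hCZ' : ∀ w, Disjoint (C w) (Z (g w)) := fun w =>
    Finset.disjoint_of_subset_left (hC w).1
      (Finset.disjoint_of_subset_right Finset.subset_union_right Finset.sdiff_disjoint)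
  refine ⟨fun w => if b w then C w else C (σ w), fun w => if b w then C (τ w) else C w, Z,
    ?_, ?_, hZρ, ?_, ?_, fun w => (hZ w).2, ?_⟩
  · intro w
    cases h : b w <;> simp [h, hbσ, hσ w]
  · intro w
    cases h : b w <;> simp [h, hbτ, hτ w]
  · intro w
    cases h : b w
    · have := hCE (σ w)
      rw [hEt _ (by rw [hbσ, h]; rfl), hP] at this
      simp [h, this, (hC (σ w)).2.1]
    · have := hCE w
      rw [hEt _ h] at this
      simp [h, this, (hC w).2.1]
  · intro w
    cases h : b w
    · have := hCE w
      rw [hEf _ h] at this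
      simp [h, this, (hC w).2.1]
    · have := hCE (τ w)
      rw [hEf _ (by rw [hbτ, h]; rfl), hQ] at this
      simp [h, this, (hC (τ w)).2.1]
  · intro w
    cases h : b w
    · have hg : g (σ w) = w := by rw [hgt _ (by rw [hbσ, h]; rfl), hσ]
      have h1 := (hC (σ w)).2.2
      have h2 := hCZ' (σ w)
      rw [hg] at h1 h2
      simp [h, h1, h2, hCZ w]
    · have hg : g (τ w) = w := by rw [hgf _ (by rw [hbτ, h]; rfl), hτ]
      have h1 := (hC (τ w)).2.2
      have h2 := hCZ' (τ w)
      rw [hg] at h1 h2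
      simp [h, h1.symm, h2, hCZ w]

/-- A matching of `V` extends to a perfect matching of two copies of `V`. -/
lemma exists_involutive_extending {V : Type*} (M : V → V → Prop) (hsymm : ∀ u v, M u v → M v u)
    (hirr : ∀ v, ¬ M v v) (huniq : ∀ u v w, M u v → M u w → v = w) :
    ∃ σ : V × Bool → V × Bool, Function.Involutive σ ∧ (∀ w, σ w ≠ w) ∧
      ∀ u v x, M u v → σ (u, x) = (v, x) := by
  classical
  let σ : V × Bool → V × Bool := fun w =>
    if h : ∃ v, M w.1 v then (h.choose, w.2) else (w.1, !w.2)
  have h1 : ∀ u v x, M u v → σ (u, x) = (v, x) := fun u v x h => by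
    have hex : ∃ v, M u v := ⟨v, h⟩
    simp only [σ, dif_pos hex]
    rw [huniq _ _ _ hex.choose_spec h]
  have h2 : ∀ u x, (¬ ∃ v, M u v) → σ (u, x) = (u, !x) := fun u x h => dif_neg h
  refine ⟨σ, ?_, ?_, h1⟩
  · rintro ⟨u, x⟩
    by_cases h : ∃ v, M u v
    · obtain ⟨v, hv⟩ := h
      rw [h1 u v x hv, h1 v u x (hsymm _ _ hv)]
    · rw [h2 u x h, h2 u _ h, Bool.not_not]
  · rintro ⟨u, x⟩ heq
    by_cases h : ∃ v, M u v
    · obtain ⟨v, hv⟩ := h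
      rw [h1 u v x hv] at heq
      obtain rfl : v = u := congrArg Prod.fst heq
      exact hirr _ hv
    · rw [h2 u x h] at heq
      have : (!x) = x := congrArg Prod.snd heq
      cases x <;> simp at this

/-- Every 3-edge-colorable graph is `(⌈7m/2⌉, m)`-edge-choosable for each positive `m`. -/
theorem stmt16 {V : Type*} (G : SimpleGraph V)
    (h3 : ∃ c : Sym2 V → Fin 3,
      ∀ e ∈ G.edgeSet, ∀ f ∈ G.edgeSet, e ≠ f → EdgeIncident e f → c e ≠ c f)
    (m : ℕ) (hm : 0 < m) :
    EdgeChoosable G ((7 * m + 1) / 2) m := by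
  classical
  obtain ⟨c, hc⟩ := h3
  intro L hL
  let M : Fin 3 → V → V → Prop := fun i u v => G.Adj u v ∧ c s(u, v) = i
  have hMsymm : ∀ i u v, M i u v → M i v u := fun i u v h => ⟨h.1.symm, Sym2.eq_swap ▸ h.2⟩
  have hMuniq : ∀ i u v w, M i u v → M i u w → v = w := by
    intro i u v w hv hw
    by_contra hne
    exact hc s(u, v) hv.1 s(u, w) hw.1 (fun h => hne (Sym2.congr_right.1 h))
      ⟨u, Sym2.mem_mk_left _ _, Sym2.mem_mk_left _ _⟩ (hv.2.trans hw.2.symm)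
  choose σ hσ hσ' hσM using fun i =>
    exists_involutive_extending (M i) (hMsymm i) (fun v h => G.loopless.irrefl v h.1) (hMuniq i)
  let A : Fin 3 → V × Bool → Finset ℕ := fun i w =>
    if M i w.1 (σ i w).1 then L s(w.1, (σ i w).1) else Finset.range ((7 * m + 1) / 2)
  have hA : ∀ i w, A i (σ i w) = A i w := fun i w => by
    have : M i (σ i w).1 w.1 ↔ M i w.1 (σ i w).1 := ⟨hMsymm _ _ _, hMsymm _ _ _⟩
    simp only [A, hσ i w, this, Sym2.eq_swap]
  have hAc : ∀ i w, (A i w).card = (7 * m + 1) / 2 := fun i w => by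
    simp only [A]
    split_ifs with h
    · exact hL _ h.1
    · simp
  have hAL : ∀ u v x, G.Adj u v → A (c s(u, v)) (u, x) = L s(u, v) := fun u v x h => by
    have hM : M (c s(u, v)) u v := ⟨h, rfl⟩
    simp only [A, hσM _ u v x hM, if_pos hM]
  obtain ⟨X, Y, Z, hX, hY, hZ, hXc, hYc, hZc, hdis⟩ := exists_selection_of_involutions
    (hσ 0) (hσ 1) (hσ 2) (hσ' 0) (hσ' 1) m (A 0) (A 1) (A 2) (hA 0) (hA 1) (hA 2)
    (hAc 0) (hAc 1) (hAc 2)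
  let C : Fin 3 → V × Bool → Finset ℕ := ![X, Y, Z]
  have hC : ∀ i w, C i (σ i w) = C i w := fun i => by
    fin_cases i
    exacts [hX, hY, hZ]
  have hCA : ∀ i w, C i w ⊆ A i w ∧ (C i w).card = m := fun i => by
    fin_cases i
    exacts [hXc, hYc, hZc]
  have hCdis : ∀ i j, i ≠ j → ∀ w, Disjoint (C i w) (C j w) := fun i j hij w => by
    obtain ⟨h1, h2, h3⟩ := hdis w
    fin_cases i <;> fin_cases j <;> first | exact absurd rfl hij | skip
    exacts [h1, h2, h1.symm, h3, h2.symm, h3.symm]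
  let K : Sym2 V → Finset ℕ := fun e => C (c e) (e.out.1, false)
  have hK : ∀ e ∈ G.edgeSet, ∀ v ∈ e, K e = C (c e) (v, false) := by
    intro e he v hv
    obtain ⟨u, rfl⟩ := Sym2.mem_iff_exists.1 hv
    rcases Sym2.mem_iff.1 (Sym2.out_fst_mem s(v, u)) with h | h
    · simp only [K, h]
    · simp only [K, h]
      rw [← hσM _ v u false ⟨he, rfl⟩, hC]
  refine ⟨K, ?_, ?_⟩
  · intro e he
    induction e with
    | h u v =>
      rw [hK _ he u (Sym2.mem_mk_left _ _), ← hAL u v false he]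
      exact hCA _ _
  · rintro e he f hf hef ⟨v, hve, hvf⟩
    rw [hK e he v hve, hK f hf v hvf]
    exact hCdis _ _ (hc e he f hf hef ⟨v, hve, hvf⟩) _
end
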